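/- arXiv:2102.05422 — 4 statements merged into one kernel-verified Lean document; each statement's English description precedes it below -/
import Mathlib

section
/- Equisatisfiability of the rewrite rule for size of an extensional set: for every element x, finite set A, and natural number m, the cardinality of insert x A equals m if and only if either (x ∉ A and m = 1 + |A|) or (there exists a finite set N with A = insert x N, x ∉ N, and |A| = m). -/
theorem size_ext_equisat {α : Type*} [DecidableEq α] (x : α) (A : Finset α) (m : ℕ) :
    (insert x A).card = m ↔
      (x ∉ A ∧ m = 1 + A.card) ∨
      (∃ N : Finset α, A = insert x N ∧ x ∉ N ∧ A.card = m) := by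
  by_cases hx : x ∈ A
  · rw [Finset.insert_eq_of_mem hx]
    constructor
    · intro h
      exact Or.inr ⟨A.erase x, (Finset.insert_erase hx).symm, Finset.notMem_erase x A, h⟩
    · rintro (⟨hx', -⟩ | ⟨-, -, -, h⟩)
      · exact absurd hx hx'
      · exact h
  · rw [Finset.card_insert_of_notMem hx]
    constructor
    · intro h
      exact Or.inl ⟨hx, by omega⟩
    · rintro (⟨-, h⟩ | ⟨N, rfl, -, -⟩)
      · omega
      · exact absurd (Finset.mem_insert_self x N) hx
end

section
/- Correctness of the set unification rule: for all elements x, y and finite sets A, B, the equality insert x A = insert y B holds if and only if (x = y and A = B), or (x = y and insert x A = B), or (x = y and A = insert y B), or there exists a finite set N such that A = insert y N and insert x N = B. -/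
theorem set_unification_eq_ext {α : Type*} [DecidableEq α] (x y : α) (A B : Finset α) :
    insert x A = insert y B ↔
      (x = y ∧ A = B) ∨
      (x = y ∧ insert x A = B) ∨
      (x = y ∧ A = insert y B) ∨
      (∃ N : Finset α, A = insert y N ∧ insert x N = B) := by
  constructor
  · intro h
    by_cases hxy : x = y
    · subst hxy
      by_cases hA : x ∈ A
      · rw [Finset.insert_eq_of_mem hA] at h
        exact Or.inr (Or.inr (Or.inl ⟨rfl, h⟩))
      by_cases hB : x ∈ B
      · rw [Finset.insert_eq_of_mem hB] at h
        exact Or.inr (Or.inl ⟨rfl, h⟩)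
      · refine Or.inl ⟨rfl, ?_⟩
        rw [← Finset.erase_insert hA, h, Finset.erase_insert hB]
    · refine Or.inr (Or.inr (Or.inr ?_))
      have hyA : y ∈ A :=
        Finset.mem_of_mem_insert_of_ne (h ▸ Finset.mem_insert_self y B) (Ne.symm hxy)
      by_cases hyB : y ∈ B
      · exact ⟨A, (Finset.insert_eq_of_mem hyA).symm, h.trans (Finset.insert_eq_of_mem hyB)⟩
      · refine ⟨A.erase y, (Finset.insert_erase hyA).symm, ?_⟩
        rw [← Finset.erase_insert_of_ne hxy, h, Finset.erase_insert hyB]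
  · rintro (⟨rfl, rfl⟩ | ⟨rfl, rfl⟩ | ⟨rfl, rfl⟩ | ⟨N, rfl, rfl⟩)
    · rfl
    · exact (Finset.insert_idem x A).symm
    · exact Finset.insert_idem x B
    · exact Finset.insert_comm x y N
end

section
/- Correctness of the union rewrite rule for an extensional first argument: for all elements x, finite sets C, A, B, the equality B = (insert x C) ∪ A holds if and only if there exist finite sets N₁ and N such that insert x C = insert x N₁, x ∉ N₁, B = insert x N, and either (x ∉ A and N = N₁ ∪ A) or (there exists a finite set N₂ with A = insert x N₂, x ∉ N₂ and N = N₁ ∪ N₂). -/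
theorem un_ext1_equisat {α : Type*} [DecidableEq α] (x : α) (C A B : Finset α) :
    B = insert x C ∪ A ↔
      ∃ N₁ N : Finset α,
        insert x C = insert x N₁ ∧ x ∉ N₁ ∧ B = insert x N ∧
        ((x ∉ A ∧ N = N₁ ∪ A) ∨
         (∃ N₂ : Finset α, A = insert x N₂ ∧ x ∉ N₂ ∧ N = N₁ ∪ N₂)) := by
  have insert_erase_eq : insert x C = insert x (C.erase x) := by
    ext y
    by_cases h : y = x <;> simp [h]
  constructor
  · rintro rfl
    by_cases hx : x ∈ A
    · refine ⟨C.erase x, C.erase x ∪ A.erase x, insert_erase_eq, Finset.notMem_erase x C, ?_,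
        Or.inr ⟨A.erase x, (Finset.insert_erase hx).symm, Finset.notMem_erase x A, rfl⟩⟩
      rw [insert_erase_eq, ← Finset.union_insert, Finset.insert_erase hx, Finset.insert_union,
        Finset.insert_eq_self.mpr (Finset.mem_union_right _ hx)]
    · exact ⟨C.erase x, C.erase x ∪ A, insert_erase_eq, Finset.notMem_erase x C,
        by rw [insert_erase_eq, Finset.insert_union], Or.inl ⟨hx, rfl⟩⟩
  · rintro ⟨N₁, N, hC, -, rfl, ⟨-, rfl⟩ | ⟨N₂, rfl, -, rfl⟩⟩
    · rw [hC, Finset.insert_union]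
    · rw [hC, Finset.insert_union, Finset.union_insert, Finset.insert_idem]
end

section
/- Correctness of the derived intersection constraint: for all finite sets A, B, C, the equality C = A ∩ B holds if and only if there exist finite sets N₁ and N₂ such that C ∪ N₁ = A, C ∪ N₂ = B, and N₁ and N₂ are disjoint. -/
theorem inters_correct {α : Type*} [DecidableEq α] (A B C : Finset α) :
    C = A ∩ B ↔
      ∃ N₁ N₂ : Finset α, C ∪ N₁ = A ∧ C ∪ N₂ = B ∧ Disjoint N₁ N₂ := by
  constructor
  · rintro rfl
    exact ⟨A \ B, B \ A, by grind, by grind, disjoint_sdiff_sdiff⟩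
  · rintro ⟨N₁, N₂, rfl, rfl, h⟩
    rw [← Finset.union_inter_distrib_left, Finset.disjoint_iff_inter_eq_empty.mp h,
      Finset.union_empty]
end
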